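/- Let k be a positive integer, σ ∈ ℝ, and q(t) := c_k·cos(2πk(t+σ)) with c_k := 2^(−1/6)·(πk)^(−1/3). If ξ : ℝ → ℝ is smooth, 1-periodic, and satisfies A_qξ = 0, then ξ is a scalar multiple of the function t ↦ sin(2πk(t+σ)). In particular the kernel of the Hessian of ℬ at q is one-dimensional and is spanned by q̇, so ℬ is Morse–Bott of nullity 1 at each critical point. -/

import Mathlib

open Real

/-- L² inner product of 1-periodic functions: `⟨f,g⟩ = ∫₀¹ f(t)g(t) dt`. -/
noncomputable def ip (f g : ℝ → ℝ) : ℝ := ∫ t in (0:ℝ)..1, f t * g t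

/-- The amplitude `c_k = 2^(-1/6) (πk)^(-1/3)`. -/
noncomputable def ck (k : ℕ) : ℝ := 2 ^ (-(1:ℝ)/6) * (Real.pi * k) ^ (-(1:ℝ)/3)

/-- `α_q = ‖q̇‖²/‖q‖² − 1/(2‖q‖⁶)`, with `‖q‖² = ⟨q,q⟩`. -/
noncomputable def alphaQ (q : ℝ → ℝ) : ℝ :=
  ip (deriv q) (deriv q) / ip q q - 1 / (2 * (ip q q) ^ 3)

/-- The Hessian operator of `ℬ` at a critical point `q`:
`A_q ξ = −ξ̈ + α_q ξ − (2/‖q‖²)(2α_q − 1/‖q‖⁶)⟨q,ξ⟩ q`. -/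
noncomputable def Hess (q ξ : ℝ → ℝ) : ℝ → ℝ := fun t =>
  -(deriv (deriv ξ) t) + alphaQ q * ξ t
    - (2 / ip q q) * (2 * alphaQ q - 1 / (ip q q) ^ 3) * ip q ξ * q t

section TrigIntegrals

variable (k : ℕ) (σ : ℝ)

lemma hasDerivAt_phase (t : ℝ) :
    HasDerivAt (fun t : ℝ => 2 * π * k * (t + σ)) (2 * π * k) t := by
  simpa using ((hasDerivAt_id t).add_const σ).const_mul (2 * π * k)

lemma cos_phase_one : Real.cos (2 * π * k * (1 + σ)) = Real.cos (2 * π * k * (0 + σ)) := by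
  rw [← Real.cos_add_nat_mul_two_pi (2 * π * k * (0 + σ)) k]
  congr 1
  ring

lemma sin_phase_one : Real.sin (2 * π * k * (1 + σ)) = Real.sin (2 * π * k * (0 + σ)) := by
  rw [← Real.sin_add_nat_mul_two_pi (2 * π * k * (0 + σ)) k]
  congr 1
  ring

variable {k}

lemma integral_cos_phase_sq (hk : 0 < k) :
    ∫ t in (0:ℝ)..1, Real.cos (2 * π * k * (t + σ)) ^ 2 = 1 / 2 := by
  have hk' : (k : ℝ) ≠ 0 := by positivity
  have hderiv (t : ℝ) : HasDerivAt
      (fun t : ℝ => t / 2 + Real.sin (2 * π * k * (t + σ)) * Real.cos (2 * π * k * (t + σ))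
        / (2 * (2 * π * k))) (Real.cos (2 * π * k * (t + σ)) ^ 2) t := by
    have h := hasDerivAt_phase k σ t
    refine (((hasDerivAt_id t).div_const 2).add
      ((h.sin.mul h.cos).div_const (2 * (2 * π * k)))).congr_deriv ?_
    have hsc := Real.sin_sq_add_cos_sq (2 * π * k * (t + σ))
    field_simp
    linear_combination (-1) * hsc
  rw [intervalIntegral.integral_eq_sub_of_hasDerivAt (fun t _ => hderiv t)
    (Continuous.intervalIntegrable (by fun_prop) _ _), cos_phase_one, sin_phase_one]
  ring

lemma integral_sin_phase_sq (hk : 0 < k) :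
    ∫ t in (0:ℝ)..1, Real.sin (2 * π * k * (t + σ)) ^ 2 = 1 / 2 := by
  simp_rw [Real.sin_sq]
  rw [intervalIntegral.integral_sub (by simp)
    (Continuous.intervalIntegrable (by fun_prop) _ _), integral_cos_phase_sq σ hk]
  norm_num

lemma integral_sin_phase_mul_cos_phase (hk : 0 < k) :
    ∫ t in (0:ℝ)..1, Real.sin (2 * π * k * (t + σ)) * Real.cos (2 * π * k * (t + σ)) = 0 := by
  have hk' : (k : ℝ) ≠ 0 := by positivity
  have hderiv (t : ℝ) : HasDerivAt
      (fun t : ℝ => Real.sin (2 * π * k * (t + σ)) ^ 2 / (2 * (2 * π * k)))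
      (Real.sin (2 * π * k * (t + σ)) * Real.cos (2 * π * k * (t + σ))) t := by
    refine (((hasDerivAt_phase k σ t).sin.pow 2).div_const (2 * (2 * π * k))).congr_deriv ?_
    field_simp
    simp only [Nat.cast_ofNat, Nat.add_one_sub_one, pow_one]
    ring
  rw [intervalIntegral.integral_eq_sub_of_hasDerivAt (fun t _ => hderiv t)
    (Continuous.intervalIntegrable (by fun_prop) _ _), sin_phase_one]
  ring

end TrigIntegrals

lemma ck_pow_six {k : ℕ} (hk : 0 < k) : ck k ^ 6 = 1 / (2 * (π * k) ^ 2) := by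
  have hpk : 0 < π * (k : ℝ) := by positivity
  have htwo : ((2:ℝ) ^ (-(1:ℝ) / 6)) ^ 6 = 2⁻¹ := by
    rw [← Real.rpow_mul_natCast (by norm_num), ← Real.rpow_neg_one]
    norm_num
  have hbase : ((π * (k : ℝ)) ^ (-(1:ℝ) / 3)) ^ 6 = ((π * k) ^ 2)⁻¹ := by
    rw [← Real.rpow_mul_natCast hpk.le, ← Real.rpow_natCast, ← Real.rpow_neg hpk.le]
    norm_num
  rw [ck, mul_pow, htwo, hbase]
  field_simp

lemma ck_pos {k : ℕ} (hk : 0 < k) : 0 < ck k := by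
  unfold ck
  positivity

section CriticalPoint

variable {k : ℕ} {σ : ℝ} {q : ℝ → ℝ}

lemma ip_self_critical (hk : 0 < k)
    (hq : ∀ t, q t = ck k * Real.cos (2 * π * k * (t + σ))) :
    ip q q = ck k ^ 2 / 2 := by
  have h (t : ℝ) : q t * q t = ck k ^ 2 * Real.cos (2 * π * k * (t + σ)) ^ 2 := by
    rw [hq]; ring
  simp_rw [ip, h]
  rw [intervalIntegral.integral_const_mul, integral_cos_phase_sq σ hk]
  ring

lemma ip_deriv_critical (hk : 0 < k)
    (hq : ∀ t, q t = ck k * Real.cos (2 * π * k * (t + σ))) :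
    ip (deriv q) (deriv q) = (2 * π * k) ^ 2 * (ck k ^ 2 / 2) := by
  have hderiv (t : ℝ) : deriv q t = ck k * (-Real.sin (2 * π * k * (t + σ)) * (2 * π * k)) := by
    rw [funext hq]
    exact ((hasDerivAt_phase k σ t).cos.const_mul (ck k)).deriv
  have h (t : ℝ) : deriv q t * deriv q t
      = (2 * π * k) ^ 2 * ck k ^ 2 * Real.sin (2 * π * k * (t + σ)) ^ 2 := by
    rw [hderiv]; ring
  simp_rw [ip, h]
  rw [intervalIntegral.integral_const_mul, integral_sin_phase_sq σ hk]
  ring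

lemma inv_ip_self_critical_pow_three (hk : 0 < k)
    (hq : ∀ t, q t = ck k * Real.cos (2 * π * k * (t + σ))) :
    1 / ip q q ^ 3 = 4 * (2 * π * k) ^ 2 := by
  have hk' : (k : ℝ) ≠ 0 := by positivity
  have h : ip q q ^ 3 = 1 / (16 * (π * k) ^ 2) := by
    rw [ip_self_critical hk hq, div_pow, ← pow_mul, ck_pow_six hk]
    field_simp
    norm_num
  rw [h]
  field_simp
  norm_num

lemma alphaQ_critical (hk : 0 < k)
    (hq : ∀ t, q t = ck k * Real.cos (2 * π * k * (t + σ))) :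
    alphaQ q = -(2 * π * k) ^ 2 := by
  have hc := (ck_pos hk).ne'
  have h : 1 / (2 * ip q q ^ 3) = 2 * (2 * π * k) ^ 2 := by
    linear_combination inv_ip_self_critical_pow_three hk hq / 2
  rw [alphaQ, h, ip_deriv_critical hk hq, ip_self_critical hk hq]
  field_simp
  ring

end CriticalPoint

/-- The kernel of the Hessian of `ℬ` at `q(t) = c_k cos(2πk(t+σ))` is one-dimensional,
spanned by `t ↦ sin(2πk(t+σ))` (a multiple of `q̇`): `ℬ` is Morse–Bott of nullity 1. -/
theorem hessian_kernel_one_dimensional (k : ℕ) (hk : 0 < k) (σ : ℝ) (q : ℝ → ℝ)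
    (hq : ∀ t, q t = ck k * Real.cos (2 * π * k * (t + σ)))
    (ξ : ℝ → ℝ) (hξ : ContDiff ℝ (⊤ : ℕ∞) ξ) (hξp : Function.Periodic ξ 1)
    (hker : ∀ t, Hess q ξ t = 0) :
    ∃ c : ℝ, ∀ t, ξ t = c * Real.sin (2 * π * k * (t + σ)) := by
  have hc := (ck_pos hk).ne'
  set ω : ℝ := 2 * π * k with hω
  have hω0 : ω ≠ 0 := by positivity
  have hξ1 (t : ℝ) : HasDerivAt ξ (deriv ξ t) t :=
    (hξ.differentiable (by simp) t).hasDerivAt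
  have hξ2 (t : ℝ) : HasDerivAt (deriv ξ) (deriv (deriv ξ) t) t :=
    ((hξ.iterate_deriv 1).differentiable (by simp) t).hasDerivAt
  obtain ⟨D, hD, hode⟩ : ∃ D, (D = 0 → ip q ξ = 0) ∧
      ∀ t, deriv (deriv ξ) t + ω ^ 2 * ξ t = D * Real.cos (ω * (t + σ)) := by
    refine ⟨2 / (ck k ^ 2 / 2) * (6 * ω ^ 2) * ip q ξ * ck k, fun h => ?_, fun t => ?_⟩
    · simpa [hω0, hc] using h
    · have h := hker t
      rw [Hess, inv_ip_self_critical_pow_three hk hq, alphaQ_critical hk hq,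
        ip_self_critical hk hq, hq t, ← hω] at h
      linear_combination -h
  -- Variation of constants: `F` and `G` are the coefficients of `ω * ξ` against `sin` and `-cos`.
  set F : ℝ → ℝ := fun t => deriv ξ t * Real.cos (ω * (t + σ)) + ω * ξ t * Real.sin (ω * (t + σ))
    with hF
  set G : ℝ → ℝ := fun t => deriv ξ t * Real.sin (ω * (t + σ)) - ω * ξ t * Real.cos (ω * (t + σ))
    with hG
  have hFd (t : ℝ) : HasDerivAt F (D * Real.cos (ω * (t + σ)) ^ 2) t := by
    have h := hasDerivAt_phase k σ t
    refine (((hξ2 t).mul h.cos).add (((hξ1 t).const_mul ω).mul h.sin)).congr_deriv ?_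
    rw [← hω]
    linear_combination Real.cos (ω * (t + σ)) * hode t
  have hGd (t : ℝ) :
      HasDerivAt G (D * Real.cos (ω * (t + σ)) * Real.sin (ω * (t + σ))) t := by
    have h := hasDerivAt_phase k σ t
    refine (((hξ2 t).mul h.sin).sub (((hξ1 t).const_mul ω).mul h.cos)).congr_deriv ?_
    rw [← hω]
    linear_combination Real.sin (ω * (t + σ)) * hode t
  have hD0 : D = 0 := by
    have hint := intervalIntegral.integral_eq_sub_of_hasDerivAt (a := 0) (b := 1)
      (fun t _ => hFd t) (Continuous.intervalIntegrable (by fun_prop) _ _)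
    have hξ01 : ξ 1 = ξ 0 := by simpa using hξp 0
    have hdξ01 : deriv ξ 1 = deriv ξ 0 := by
      have h := deriv_comp_add_const ξ 1 0
      rw [show (fun x => ξ (x + 1)) = ξ from funext hξp, zero_add] at h
      exact h.symm
    rw [intervalIntegral.integral_const_mul, integral_cos_phase_sq σ hk] at hint
    simp only [hF, hω] at hint
    rw [cos_phase_one, sin_phase_one, hξ01, hdξ01] at hint
    linarith
  have hFc (t : ℝ) : F t = F 0 :=
    is_const_of_deriv_eq_zero (fun t => (hFd t).differentiableAt)
      (fun t => by rw [(hFd t).deriv, hD0, zero_mul]) t 0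
  have hGc (t : ℝ) : G t = G 0 :=
    is_const_of_deriv_eq_zero (fun t => (hGd t).differentiableAt)
      (fun t => by rw [(hGd t).deriv, hD0, zero_mul, zero_mul]) t 0
  have hsol (t : ℝ) :
      ξ t = F 0 / ω * Real.sin (ω * (t + σ)) - G 0 / ω * Real.cos (ω * (t + σ)) := by
    rw [← hFc t, ← hGc t]
    simp only [hF, hG]
    field_simp
    linear_combination (-ξ t * ω) * Real.sin_sq_add_cos_sq (ω * (t + σ))
  have hG0 : G 0 / ω = 0 := by
    have hip : ip q ξ = -(ck k * (G 0 / ω) / 2) := by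
      have h (t : ℝ) : q t * ξ t
          = ck k * (F 0 / ω) * (Real.sin (ω * (t + σ)) * Real.cos (ω * (t + σ)))
            - ck k * (G 0 / ω) * Real.cos (ω * (t + σ)) ^ 2 := by
        rw [hq, hsol]; ring
      simp_rw [ip, h]
      rw [intervalIntegral.integral_sub (Continuous.intervalIntegrable (by fun_prop) _ _)
        (Continuous.intervalIntegrable (by fun_prop) _ _),
        intervalIntegral.integral_const_mul, intervalIntegral.integral_const_mul,
        integral_sin_phase_mul_cos_phase σ hk, integral_cos_phase_sq σ hk]
      ring
    rw [hD hD0] at hip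
    have h : ck k * (G 0 / ω) = 0 := by linarith
    exact (mul_eq_zero.mp h).resolve_left hc
  exact ⟨F 0 / ω, fun t => by rw [hsol t, hG0]; ring⟩
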